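/- arXiv:1602.06454 — 3 statements merged into one kernel-verified Lean document; each statement's English description precedes it below -/
import Mathlib

section
/- Let U be a finite set, let k be a natural number, and let g, o : Fin k → Finset U be two sequences of subsets of U (the greedy picks and the optimal picks). Write G = ⋃_{j<k} g(j). If for every j < k the number of new elements the j-th greedy pick adds satisfies |g(j) \ ⋃_{h<j} g(h)| ≥ |o(j) \ G|, then 2·|G| ≥ |⋃_{j<k} o(j)|, i.e. the greedy picks cover at least half as many elements as the optimal picks. -/
/-- The marginal gains of a family of finsets indexed by a linear order sum to at most the
cardinality of its union, since they are pairwise disjoint. -/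
theorem Finset.sum_card_sdiff_biUnion_Iio_le {ι U : Type*} [LinearOrder ι]
    [LocallyFiniteOrderBot ι] [DecidableEq U] (s : Finset ι) (g : ι → Finset U) :
    ∑ j ∈ s, (g j \ (Finset.Iio j).biUnion g).card ≤ (s.biUnion g).card := by
  have disjoint_of_lt : ∀ i j, i < j →
      Disjoint (g i \ (Finset.Iio i).biUnion g) (g j \ (Finset.Iio j).biUnion g) := by
    intro i j hij
    refine Finset.disjoint_left.2 fun x hi hj => (Finset.mem_sdiff.1 hj).2 ?_
    exact Finset.mem_biUnion.2 ⟨i, Finset.mem_Iio.2 hij, (Finset.mem_sdiff.1 hi).1⟩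
  rw [← Finset.card_biUnion fun i _ j _ hij =>
    hij.lt_or_gt.elim (disjoint_of_lt i j) fun hji => (disjoint_of_lt j i hji).symm]
  exact Finset.card_le_card (Finset.biUnion_mono fun j _ => Finset.sdiff_subset)

/-- Abstract core of Theorem 2 (2-approximation of greedy A-IC-TA):
if each greedy marginal gain dominates the corresponding optimal pick's
elements outside the greedy coverage `G`, then the greedy coverage is at
least half the optimal coverage. -/
theorem greedy_two_approx {U : Type*} [DecidableEq U] (k : ℕ)
    (g o : Fin k → Finset U) (G : Finset U)
    (hG : G = Finset.univ.biUnion g)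
    (h : ∀ j : Fin k, ((o j) \ G).card ≤ (g j \ (Finset.Iio j).biUnion g).card) :
    (Finset.univ.biUnion o).card ≤ 2 * G.card := by
  subst hG
  set G := Finset.univ.biUnion g
  have cover : Finset.univ.biUnion o ⊆ G ∪ Finset.univ.biUnion fun j => o j \ G := by
    intro x hx
    by_cases hxG : x ∈ G <;> simp_all
  calc (Finset.univ.biUnion o).card
      ≤ (G ∪ Finset.univ.biUnion fun j => o j \ G).card := Finset.card_le_card cover
    _ ≤ G.card + (Finset.univ.biUnion fun j => o j \ G).card := Finset.card_union_le _ _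
    _ ≤ G.card + ∑ j, (o j \ G).card := by gcongr; exact Finset.card_biUnion_le
    _ ≤ G.card + ∑ j, (g j \ (Finset.Iio j).biUnion g).card :=
      Nat.add_le_add_left (Finset.sum_le_sum fun j _ => h j) _
    _ ≤ G.card + G.card := by gcongr; exact Finset.sum_card_sdiff_biUnion_Iio_le _ g
    _ = 2 * G.card := (two_mul _).symm
end

section
/- Let S ⊆ S' ⊆ T with S ∩ T⁺ = S' ∩ T⁺ (the two sets contain the same positive tags), and let t ∈ T⁺ with t ∉ S'. Suppose that: (i) c(t) ⊆ N(S'), i.e. every attribute value covered by t is covered by some negative tag in S'; (ii) c(t) ∩ N(S) = ∅, i.e. no attribute value covered by t is covered by any negative tag in S; (iii) c(t) ∩ P(S') = ∅, i.e. no attribute value covered by t is covered by the positive tags already selected; and (iv) c(t) ⊆ A⁻. Then cov_DC(S' ∪ {t}) − cov_DC(S') = |c(t)| while cov_DC(S ∪ {t}) − cov_DC(S) = 0. In particular, if c(t) is nonempty, the marginal gain of t on the superset S' strictly exceeds its marginal gain on the subset S. -/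
/-- `P(S)`: attribute values covered by the positive tags in `S`. -/
def covP {τ α : Type*} [DecidableEq τ] [DecidableEq α]
    (Tp : Finset τ) (c : τ → Finset α) (S : Finset τ) : Finset α :=
  (S ∩ Tp).biUnion c

/-- `N(S)`: attribute values covered by the negative tags in `S`. -/
def covN {τ α : Type*} [DecidableEq τ] [DecidableEq α]
    (Tn : Finset τ) (c : τ → Finset α) (S : Finset τ) : Finset α :=
  (S ∩ Tn).biUnion c

/-- The dependent coverage `cov_DC(S)` of Equation 2. -/
def covDC {τ α : Type*} [DecidableEq τ] [DecidableEq α]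
    (Tp Tn : Finset τ) (c : τ → Finset α) (S : Finset τ) : ℕ :=
  (covP Tp c S ∩ covN Tn c S).card
    + (covP Tp c S \ Tn.biUnion c).card
    + (covN Tn c S \ Tp.biUnion c).card

theorem covP_insert_of_mem {τ α : Type*} [DecidableEq τ] [DecidableEq α]
    {Tp : Finset τ} (c : τ → Finset α) (S : Finset τ) {t : τ} (ht : t ∈ Tp) :
    covP Tp c (insert t S) = c t ∪ covP Tp c S := by
  simp [covP, Finset.insert_inter_of_mem ht]

theorem covN_insert_of_notMem {τ α : Type*} [DecidableEq τ] [DecidableEq α]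
    {Tn : Finset τ} (c : τ → Finset α) (S : Finset τ) {t : τ} (ht : t ∉ Tn) :
    covN Tn c (insert t S) = covN Tn c S := by
  simp [covN, Finset.insert_inter_of_notMem ht]

/-- Adding a positive tag whose values all lie in the negative range only enlarges
the overlap of positive and negative coverage. -/
theorem covDC_insert {τ α : Type*} [DecidableEq τ] [DecidableEq α]
    {Tp Tn : Finset τ} (c : τ → Finset α) (hdisj : Disjoint Tp Tn) (S : Finset τ) {t : τ}
    (ht : t ∈ Tp) (hP : Disjoint (c t) (covP Tp c S)) (hc : c t ⊆ Tn.biUnion c) :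
    covDC Tp Tn c (insert t S) = covDC Tp Tn c S + (c t ∩ covN Tn c S).card := by
  unfold covDC
  rw [covP_insert_of_mem c S ht,
    covN_insert_of_notMem c S (Finset.disjoint_left.mp hdisj ht),
    Finset.union_inter_distrib_right, Finset.union_sdiff_distrib,
    Finset.sdiff_eq_empty_iff_subset.mpr hc, Finset.empty_union,
    Finset.card_union_of_disjoint
      (hP.mono Finset.inter_subset_left Finset.inter_subset_left)]
  omega

/-- Quantitative marginal-gain computation underlying the paper's Theorem 4:
under hypotheses (i)-(iv), adding the positive tag `t` to `S'` gains `|c(t)|`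
while adding it to `S` gains nothing; in particular if `c(t)` is nonempty the
marginal gain on the superset strictly exceeds that on the subset. -/
theorem covDC_marginal_gain {τ α : Type*} [DecidableEq τ] [DecidableEq α]
    (Tp Tn : Finset τ) (c : τ → Finset α)
    (hdisj : Disjoint Tp Tn)
    (S S' : Finset τ) (hSS' : S ⊆ S') (hS'T : S' ⊆ Tp ∪ Tn)
    (hpos : S ∩ Tp = S' ∩ Tp)
    (t : τ) (ht : t ∈ Tp) (htS' : t ∉ S')
    (h1 : c t ⊆ covN Tn c S')
    (h2 : c t ∩ covN Tn c S = ∅)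
    (h3 : c t ∩ covP Tp c S' = ∅)
    (h4 : c t ⊆ Tn.biUnion c) :
    covDC Tp Tn c (insert t S') = covDC Tp Tn c S' + (c t).card ∧
    covDC Tp Tn c (insert t S) = covDC Tp Tn c S ∧
    ((c t).Nonempty →
      (covDC Tp Tn c (insert t S) : ℤ) - (covDC Tp Tn c S : ℤ)
        < (covDC Tp Tn c (insert t S') : ℤ) - (covDC Tp Tn c S' : ℤ)) := by
  have hP' : Disjoint (c t) (covP Tp c S') := Finset.disjoint_iff_inter_eq_empty.mpr h3
  have hP : Disjoint (c t) (covP Tp c S) := by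
    rwa [covP, hpos]
  have gain' := covDC_insert c hdisj S' ht hP' h4
  have gain := covDC_insert c hdisj S ht hP h4
  rw [Finset.inter_eq_left.mpr h1] at gain'
  rw [h2, Finset.card_empty, add_zero] at gain
  refine ⟨gain', gain, fun hne => ?_⟩
  have := hne.card_pos
  omega
end

section
/- Let S ⊆ T be a set of tags containing at least one positive tag and at least one negative tag. Define the augmented (dummy-edge) coverage sets P'(S) = P(S) ∪ (A⁻ \ A⁺) and N'(S) = N(S) ∪ (A⁺ \ A⁻). Then |P'(S) ∩ N'(S)| = cov_DC(S). In other words, after adding the dummy edges (every attribute value covered only by negative tags is attached to all positive tags, and every attribute value covered only by positive tags is attached to all negative tags), the dependent coverage of Equation 2 reduces to the single condition that an attribute value is covered by both a selected positive tag and a selected negative tag. -/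
/-- If `P ⊆ A` and `N ⊆ B`, then `(P ∪ (B \ A)) ∩ (N ∪ (A \ B))` is the disjoint union of
`P ∩ N`, `P \ B` and `N \ A`. -/
theorem card_union_sdiff_inter_union_sdiff {α : Type*} [DecidableEq α] {P N A B : Finset α}
    (hP : P ⊆ A) (hN : N ⊆ B) :
    ((P ∪ (B \ A)) ∩ (N ∪ (A \ B))).card
      = (P ∩ N).card + (P \ B).card + (N \ A).card := by
  have h₁ : Disjoint (P ∩ N) (P \ B) := by
    rw [Finset.disjoint_left]
    grind
  have h₂ : Disjoint (P ∩ N ∪ P \ B) (N \ A) := by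
    rw [Finset.disjoint_left]
    grind
  rw [← Finset.card_union_of_disjoint h₁, ← Finset.card_union_of_disjoint h₂]
  congr 1
  ext x
  grind

/-- Dummy-node construction of Section 4: with the augmented coverage sets
`P'(S) = P(S) ∪ (A⁻ \ A⁺)` and `N'(S) = N(S) ∪ (A⁺ \ A⁻)`, the dependent
coverage reduces to the single condition `|P'(S) ∩ N'(S)|`. -/
theorem covDC_dummy {τ α : Type*} [DecidableEq τ] [DecidableEq α]
    (Tp Tn : Finset τ) (c : τ → Finset α) (S : Finset τ)
    (hS : S ⊆ Tp ∪ Tn)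
    (hpos : (S ∩ Tp).Nonempty) (hneg : (S ∩ Tn).Nonempty) :
    ((covP Tp c S ∪ (Tn.biUnion c \ Tp.biUnion c))
      ∩ (covN Tn c S ∪ (Tp.biUnion c \ Tn.biUnion c))).card
      = covDC Tp Tn c S := by
  exact card_union_sdiff_inter_union_sdiff
    (Finset.biUnion_subset_biUnion_of_subset_left c Finset.inter_subset_right)
    (Finset.biUnion_subset_biUnion_of_subset_left c Finset.inter_subset_right)
end
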